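/- Let d ≥ 3 and λ = (d−2)/2. Then there exists a constant C > 0 such that for every integer n ≥ 1 and every f ∈ L²(S^{d-1}, σ), ‖T_n f‖_∞ ≤ C · n^{λ} · ‖f‖_1. -/

import Mathlib

open MeasureTheory Metric
open scoped ENNReal

noncomputable section

/-- The unit sphere `S^{d-1}` in `ℝ^d`. -/
abbrev Sph (d : ℕ) := Metric.sphere (0 : EuclideanSpace ℝ (Fin d)) 1

/-- The surface measure `σ` on the unit sphere in `ℝ^d`. -/
def sphMeasure (d : ℕ) : Measure (Sph d) :=
  (volume : Measure (EuclideanSpace ℝ (Fin d))).toSphere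

/-- `Y : S^{d-1} → ℝ` is a spherical harmonic of degree `n` if it is the restriction to
`S^{d-1}` of a polynomial in `d` real variables that is homogeneous of degree `n` and
harmonic (the sum of its second partial derivatives vanishes identically). -/
def IsSphericalHarmonic (d n : ℕ) (Y : Sph d → ℝ) : Prop :=
  ∃ P : MvPolynomial (Fin d) ℝ, P.IsHomogeneous n ∧
    (∑ i : Fin d, MvPolynomial.pderiv i (MvPolynomial.pderiv i P)) = 0 ∧
    ∀ x : Sph d, Y x = MvPolynomial.eval (fun i => (x : EuclideanSpace ℝ (Fin d)) i) P

/-- `H_k^d`: the subspace of `L²(S^{d-1}, σ)` consisting of (equivalence classes of)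
spherical harmonics of degree `k`. -/
def Hspace (d k : ℕ) : Submodule ℝ (Lp ℝ 2 (sphMeasure d)) :=
  Submodule.span ℝ {f : Lp ℝ 2 (sphMeasure d) |
    ∃ Y : Sph d → ℝ, IsSphericalHarmonic d k Y ∧ ⇑f =ᵐ[sphMeasure d] Y}

/-- `T` is the orthogonal projection of `L²(S^{d-1}, σ)` onto `H_k^d`: it maps into
`H_k^d` and `f - T f` is orthogonal to `H_k^d` for every `f`. -/
def IsOrthProjOnto (d k : ℕ)
    (T : Lp ℝ 2 (sphMeasure d) → Lp ℝ 2 (sphMeasure d)) : Prop :=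
  ∀ f : Lp ℝ 2 (sphMeasure d), T f ∈ Hspace d k ∧
    ∀ g ∈ Hspace d k, @inner ℝ _ _ (f - T f) g = 0

/-- The constant `c_n = (Γ(d/2)/(2π^{d/2})) ((d+2n-2)/(d+n-2)) Γ(d+n-1)/(Γ(n+1)Γ(d-1))`. -/
def cCoef (d n : ℕ) : ℝ :=
  Real.Gamma ((d : ℝ) / 2) / (2 * Real.pi ^ ((d : ℝ) / 2)) *
    (((d : ℝ) + 2 * (n : ℝ) - 2) / ((d : ℝ) + (n : ℝ) - 2)) *
    (Real.Gamma ((d : ℝ) + (n : ℝ) - 1) /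
      (Real.Gamma ((n : ℝ) + 1) * Real.Gamma ((d : ℝ) - 1)))

/-- The operator `T_n f = ∑_{j=0}^{d-2} (-1)^j binom(d-2, j) (c_n / c_{n+2j}) proj_{n+2j} f`
on `L²(S^{d-1}, σ)`, built from the orthogonal projections `proj_k` onto `H_k^d`. -/
def Tconv (d : ℕ) (proj : ℕ → Lp ℝ 2 (sphMeasure d) → Lp ℝ 2 (sphMeasure d)) (n : ℕ)
    (f : Lp ℝ 2 (sphMeasure d)) : Lp ℝ 2 (sphMeasure d) :=
  ∑ j ∈ Finset.range (d - 1),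
    ((-1 : ℝ) ^ j * ((d - 2).choose j : ℝ) * (cCoef d n / cCoef d (n + 2 * j))) •
      proj (n + 2 * j) f

open MvPolynomial in
/-- The derivative of a polynomial in the constant direction `x`. -/
def dirDeriv {d : ℕ} (x : Fin d → ℝ) :
    Derivation ℝ (MvPolynomial (Fin d) ℝ) (MvPolynomial (Fin d) ℝ) :=
  ∑ i, x i • pderiv i

open MvPolynomial in
/-- The Laplacian of a polynomial. -/
def polyLaplacian (d : ℕ) : MvPolynomial (Fin d) ℝ →ₗ[ℝ] MvPolynomial (Fin d) ℝ :=
  ∑ i, (pderiv i).toLinearMap ∘ₗ (pderiv i).toLinearMap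

open MvPolynomial in
/-- The linear form `y ↦ ⟪x, y⟫`. -/
def linForm {d : ℕ} (x : Fin d → ℝ) : MvPolynomial (Fin d) ℝ := ∑ i, C (x i) * X i

open MvPolynomial in
/-- The quadratic form `y ↦ ‖y‖ ^ 2`. -/
def normSqPoly (d : ℕ) : MvPolynomial (Fin d) ℝ := ∑ i, X i ^ 2

section Polynomials

open MvPolynomial

variable {d : ℕ} (x : Fin d → ℝ)

lemma dirDeriv_apply (P : MvPolynomial (Fin d) ℝ) :
    dirDeriv x P = ∑ i, C (x i) * pderiv i P := by
  have h (s : Finset (Fin d)) :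
      (∑ i ∈ s, x i • pderiv i : Derivation ℝ _ (MvPolynomial (Fin d) ℝ)) P =
        ∑ i ∈ s, C (x i) * pderiv i P := by
    induction s using Finset.cons_induction with
    | empty => simp
    | cons a s ha ih =>
      rw [Finset.sum_cons, Finset.sum_cons, Derivation.add_apply, ih, Derivation.smul_apply,
        smul_eq_C_mul]
  exact h _

lemma polyLaplacian_apply (P : MvPolynomial (Fin d) ℝ) :
    polyLaplacian d P = ∑ i, pderiv i (pderiv i P) := by
  simp [polyLaplacian]

lemma polyLaplacian_mul (P Q : MvPolynomial (Fin d) ℝ) :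
    polyLaplacian d (P * Q) =
      P * polyLaplacian d Q + Q * polyLaplacian d P + 2 * ∑ i, pderiv i P * pderiv i Q := by
  simp only [polyLaplacian_apply, Finset.mul_sum, ← Finset.sum_add_distrib]
  refine Finset.sum_congr rfl fun i _ => ?_
  simp only [Derivation.leibniz, smul_eq_mul, map_add]
  ring

lemma polyLaplacian_C (a : ℝ) : polyLaplacian d (C a) = 0 := by
  simp [polyLaplacian_apply]

lemma polyLaplacian_C_mul (a : ℝ) (P : MvPolynomial (Fin d) ℝ) :
    polyLaplacian d (C a * P) = C a * polyLaplacian d P := by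
  rw [← smul_eq_C_mul, map_smul, smul_eq_C_mul]

lemma dirDeriv_C_mul (a : ℝ) (P : MvPolynomial (Fin d) ℝ) :
    dirDeriv x (C a * P) = C a * dirDeriv x P := by
  rw [← smul_eq_C_mul, Derivation.map_smul, smul_eq_C_mul]

lemma pderiv_linForm (i : Fin d) : pderiv i (linForm x) = C (x i) := by
  simp [linForm, pderiv_X, Pi.single_apply]

lemma pderiv_normSqPoly (i : Fin d) : pderiv i (normSqPoly d) = 2 * X i := by
  simp [normSqPoly, pderiv_X, Pi.single_apply]

lemma dirDeriv_linForm : dirDeriv x (linForm x) = C (∑ i, x i ^ 2) := by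
  simp [dirDeriv_apply, pderiv_linForm, pow_two]

lemma dirDeriv_normSqPoly : dirDeriv x (normSqPoly d) = 2 * linForm x := by
  simp only [dirDeriv_apply, pderiv_normSqPoly, linForm, Finset.mul_sum]
  exact Finset.sum_congr rfl fun i _ => by ring

lemma polyLaplacian_linForm_mul (P : MvPolynomial (Fin d) ℝ) :
    polyLaplacian d (linForm x * P) = linForm x * polyLaplacian d P + 2 * dirDeriv x P := by
  rw [polyLaplacian_mul]
  simp [polyLaplacian_apply, pderiv_linForm, dirDeriv_apply]

lemma polyLaplacian_normSqPoly_mul {P : MvPolynomial (Fin d) ℝ} {n : ℕ}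
    (hP : P.IsHomogeneous n) :
    polyLaplacian d (normSqPoly d * P) =
      normSqPoly d * polyLaplacian d P + C (2 * d + 4 * n : ℝ) * P := by
  have h := hP.sum_X_mul_pderiv
  rw [polyLaplacian_mul]
  simp only [polyLaplacian_apply, pderiv_normSqPoly, mul_assoc, ← Finset.mul_sum, h]
  have h2 (i : Fin d) : pderiv i (2 * X i : MvPolynomial (Fin d) ℝ) = 2 := by
    rw [← map_ofNat (C : ℝ →+* MvPolynomial (Fin d) ℝ) 2, pderiv_C_mul]
    simp
  simp only [h2, Finset.sum_const, Finset.card_univ, Fintype.card_fin, nsmul_eq_mul, map_add,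
    map_mul, map_ofNat, map_natCast]
  ring

lemma dirDeriv_polyLaplacian_comm (P : MvPolynomial (Fin d) ℝ) :
    polyLaplacian d (dirDeriv x P) = dirDeriv x (polyLaplacian d P) := by
  have hc (i j : Fin d) (Q : MvPolynomial (Fin d) ℝ) :
      pderiv i (pderiv j Q) = pderiv j (pderiv i Q) := by
    have h : ⁅pderiv (R := ℝ) i, pderiv (R := ℝ) j⁆ = 0 := by
      refine MvPolynomial.derivation_ext fun k => ?_
      simp [Derivation.commutator_apply, pderiv_X, Pi.single_apply, apply_ite]
    have := DFunLike.congr_fun h Q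
    rwa [Derivation.commutator_apply, Derivation.coe_zero, Pi.zero_apply, sub_eq_zero] at this
  simp only [polyLaplacian_apply, dirDeriv_apply, map_sum, pderiv_C_mul]
  rw [Finset.sum_comm]
  refine Finset.sum_congr rfl fun j _ => Finset.sum_congr rfl fun i _ => ?_
  rw [hc j i P, hc j i]

lemma isHomogeneous_linForm : (linForm x).IsHomogeneous 1 := by
  refine IsHomogeneous.sum _ _ _ fun i _ => ?_
  simpa using (isHomogeneous_C (Fin d) (x i)).mul (isHomogeneous_X ℝ i)

lemma isHomogeneous_normSqPoly : (normSqPoly d).IsHomogeneous 2 := by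
  refine IsHomogeneous.sum _ _ _ fun i _ => ?_
  simpa using (isHomogeneous_X ℝ i).pow 2

lemma isHomogeneous_C_mul' {P : MvPolynomial (Fin d) ℝ} {n : ℕ} (a : ℝ) (hP : P.IsHomogeneous n) :
    (C a * P).IsHomogeneous n := by
  simpa using (isHomogeneous_C (Fin d) a).mul hP

lemma isHomogeneous_dirDeriv {P : MvPolynomial (Fin d) ℝ} {n : ℕ} (hP : P.IsHomogeneous n) :
    (dirDeriv x P).IsHomogeneous (n - 1) := by
  rw [dirDeriv_apply]
  exact IsHomogeneous.sum _ _ _ fun i _ => isHomogeneous_C_mul' _ hP.pderiv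

lemma eval_linForm (y : Fin d → ℝ) : eval y (linForm x) = ∑ i, x i * y i := by
  simp [linForm]

lemma eval_normSqPoly (y : Fin d → ℝ) : eval y (normSqPoly d) = ∑ i, y i ^ 2 := by
  simp [normSqPoly]

lemma eval_dirDeriv_self {P : MvPolynomial (Fin d) ℝ} {n : ℕ} (hP : P.IsHomogeneous n) :
    eval x (dirDeriv x P) = n * eval x P := by
  have h := congrArg (eval x) hP.sum_X_mul_pderiv
  simpa [dirDeriv_apply] using h

end Polynomials

open MvPolynomial in
/-- The zonal harmonic polynomial of degree `n` in `d` variables with pole `x`, normalised to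
take the value `1` at `x` when `x` is a unit vector. -/
def zonalPoly {d : ℕ} (x : Fin d → ℝ) : ℕ → MvPolynomial (Fin d) ℝ
  | 0 => 1
  | 1 => linForm x
  | n + 2 =>
    C (1 / (n + 1 + (d - 2)) : ℝ) *
      (C (2 * (n + 1) + (d - 2) : ℝ) * (linForm x * zonalPoly x (n + 1)) -
        C (n + 1 : ℝ) * (normSqPoly d * zonalPoly x n))

section Zonal

open MvPolynomial

variable {d : ℕ} (x : Fin d → ℝ)

lemma zonalPoly_rec (hd : 3 ≤ d) (n : ℕ) :
    C (n + 1 + (d - 2) : ℝ) * zonalPoly x (n + 2) =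
      C (2 * (n + 1) + (d - 2) : ℝ) * (linForm x * zonalPoly x (n + 1)) -
        C (n + 1 : ℝ) * (normSqPoly d * zonalPoly x n) := by
  have h3 : (3 : ℝ) ≤ d := by exact_mod_cast hd
  have h : (n + 1 + (d - 2) : ℝ) ≠ 0 := by
    have : (0 : ℝ) ≤ n := Nat.cast_nonneg _
    linarith
  rw [zonalPoly, ← mul_assoc, ← C_mul, mul_one_div_cancel h]
  simp

lemma isHomogeneous_zonalPoly (n : ℕ) : (zonalPoly x n).IsHomogeneous n := by
  induction n using Nat.twoStepInduction with
  | zero => exact isHomogeneous_one _ _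
  | one => exact isHomogeneous_linForm x
  | more n h0 h1 =>
    rw [zonalPoly]
    refine isHomogeneous_C_mul' _ (IsHomogeneous.sub ?_ ?_)
    · have := (isHomogeneous_linForm x).mul h1
      rw [show 1 + (n + 1) = n + 2 by ring] at this
      exact isHomogeneous_C_mul' _ this
    · have := isHomogeneous_normSqPoly.mul h0
      rw [show 2 + n = n + 2 by ring] at this
      exact isHomogeneous_C_mul' _ this

lemma C_mul_left_cancel' {a : ℝ} (ha : a ≠ 0) {P Q : MvPolynomial (Fin d) ℝ}
    (h : C a * P = C a * Q) : P = Q :=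
  mul_left_cancel₀ (by simpa using ha) h

lemma dirDeriv_zonalPoly (hd : 3 ≤ d) (hx : ∑ i, x i ^ 2 = 1) (n : ℕ) :
    dirDeriv x (zonalPoly x (n + 1)) = C (n + 1 : ℝ) * zonalPoly x n := by
  have h3 : (3 : ℝ) ≤ d := by exact_mod_cast hd
  induction n using Nat.twoStepInduction with
  | zero => simp [zonalPoly, dirDeriv_linForm, hx]
  | one =>
    have h : (0 + 1 + (d - 2) : ℝ) ≠ 0 := by linarith
    refine C_mul_left_cancel' h ?_
    have := congrArg (dirDeriv x) (zonalPoly_rec x hd 0)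
    simp only [dirDeriv_C_mul, map_sub] at this
    simp only [Derivation.leibniz, smul_eq_mul,
      dirDeriv_linForm, dirDeriv_normSqPoly, hx] at this
    simp only [Nat.cast_zero, Nat.cast_one, zero_add] at this ⊢
    rw [this]
    simp only [zonalPoly, Derivation.map_one_eq_zero, dirDeriv_linForm, hx, map_sub, map_add,
      map_mul, map_one, map_ofNat, map_natCast]
    ring
  | more n h0 h1 =>
    have h : ((n + 1 : ℕ) + 1 + (d - 2) : ℝ) ≠ 0 := by
      have : (0 : ℝ) ≤ (n + 1 : ℕ) := Nat.cast_nonneg _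
      linarith
    have h' := congrArg (dirDeriv x) (zonalPoly_rec x hd (n + 1))
    have h2 := zonalPoly_rec x hd n
    simp only [dirDeriv_C_mul, map_sub] at h'
    simp only [Derivation.leibniz, smul_eq_mul,
      dirDeriv_linForm, dirDeriv_normSqPoly, hx, h0, h1] at h'
    refine C_mul_left_cancel' h ?_
    rw [h']
    simp only [map_sub, map_add, map_mul, map_one, map_ofNat, map_natCast, Nat.cast_add,
      Nat.cast_one] at h2 ⊢
    linear_combination (-n - 2) * h2

lemma polyLaplacian_zonalPoly (hd : 3 ≤ d) (hx : ∑ i, x i ^ 2 = 1) (n : ℕ) :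
    polyLaplacian d (zonalPoly x n) = 0 := by
  have h3 : (3 : ℝ) ≤ d := by exact_mod_cast hd
  induction n using Nat.twoStepInduction with
  | zero => simpa [zonalPoly] using polyLaplacian_C (d := d) 1
  | one => simp [zonalPoly, polyLaplacian_apply, pderiv_linForm]
  | more n h0 h1 =>
    have h : (n + 1 + (d - 2) : ℝ) ≠ 0 := by
      have : (0 : ℝ) ≤ n := Nat.cast_nonneg _
      linarith
    refine C_mul_left_cancel' h ?_
    have := congrArg (polyLaplacian d) (zonalPoly_rec x hd n)
    simp only [polyLaplacian_C_mul, map_sub, polyLaplacian_linForm_mul,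
      polyLaplacian_normSqPoly_mul (isHomogeneous_zonalPoly x n), h0, h1,
      dirDeriv_zonalPoly x hd hx] at this
    rw [this]
    simp only [map_sub, map_add, map_mul, map_one, map_ofNat, map_natCast]
    ring

/-- The harmonic projection of `⟪x, ·⟫ * P`, where `P` is harmonic of degree `n`. -/
lemma polyLaplacian_linForm_mul_sub {P : MvPolynomial (Fin d) ℝ} {n : ℕ} (hd : 3 ≤ d)
    (hP : P.IsHomogeneous (n + 1)) (hL : polyLaplacian d P = 0) :
    polyLaplacian d (linForm x * P -
      C (1 / (d + 2 * n) : ℝ) * (normSqPoly d * dirDeriv x P)) = 0 := by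
  have h3 : (3 : ℝ) ≤ d := by exact_mod_cast hd
  have h : (d + 2 * n : ℝ) ≠ 0 := by
    have : (0 : ℝ) ≤ n := Nat.cast_nonneg _
    linarith
  have hh := isHomogeneous_dirDeriv x hP
  rw [map_sub, polyLaplacian_C_mul, polyLaplacian_linForm_mul,
    polyLaplacian_normSqPoly_mul hh, dirDeriv_polyLaplacian_comm, hL, map_zero]
  have : (1 / (d + 2 * n) * (2 * d + 4 * n) : ℝ) = 2 := by
    field_simp
    ring
  rw [mul_zero, mul_zero, zero_add, zero_add, ← mul_assoc, ← C_mul, Nat.add_sub_cancel, this,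
    map_ofNat, sub_self]

end Zonal

section Orthogonality

open MvPolynomial

lemma integral_eq_toSphere_mul {E : Type*} [NormedAddCommGroup E] [NormedSpace ℝ E]
    [FiniteDimensional ℝ E] [Nontrivial E] [MeasurableSpace E] [BorelSpace E] (μ : Measure E)
    [μ.IsAddHaarMeasure] {F : E → ℝ} {g : sphere (0 : E) 1 → ℝ} {h : ℝ → ℝ}
    (hF : ∀ (s : sphere (0 : E) 1) (r : ℝ), 0 < r → F (r • (s : E)) = g s * h r) :
    ∫ y, F y ∂μ = (∫ s, g s ∂μ.toSphere) *
      ∫ r : Set.Ioi (0 : ℝ), h r ∂(Measure.volumeIoiPow (Module.finrank ℝ E - 1)) := by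
  have key (y : ({(0)}ᶜ : Set E)) :
      g (homeomorphUnitSphereProd E y).1 * h (homeomorphUnitSphereProd E y).2 = F y.1 := by
    rw [← hF _ _ (homeomorphUnitSphereProd E y).2.2]
    congr 1
    have hy : ‖(y : E)‖ ≠ 0 := norm_ne_zero_iff.2 y.2
    simp [smul_smul, hy]
  calc
    ∫ y, F y ∂μ = ∫ y : ({(0)}ᶜ : Set E), F y.1 ∂(μ.comap (↑)) := by
      rw [integral_subtype_comap (measurableSet_singleton _).compl F,
        MeasureTheory.restrict_compl_singleton]
    _ = ∫ p, g p.1 * h p.2 ∂μ.toSphere.prod (.volumeIoiPow (Module.finrank ℝ E - 1)) := by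
      rw [← μ.measurePreserving_homeomorphUnitSphereProd.integral_comp
        (Homeomorph.measurableEmbedding _)]
      exact integral_congr_ae (.of_forall fun y => (key y).symm)
    _ = _ :=
      integral_prod_mul g fun r : Set.Ioi (0 : ℝ) => h r

lemma hasDerivAt_max_zero_sq (u : ℝ) :
    HasDerivAt (fun u : ℝ => max 0 u ^ 2) (2 * max 0 u) u := by
  rcases lt_trichotomy u 0 with h | rfl | h
  · rw [max_eq_left h.le, mul_zero]
    refine (hasDerivAt_const u (0 : ℝ)).congr_of_eventuallyEq ?_
    filter_upwards [Iio_mem_nhds h] with v hv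
    simp [max_eq_left (le_of_lt (Set.mem_Iio.1 hv))]
  · rw [max_self, mul_zero, hasDerivAt_iff_isLittleO]
    have h2 : (fun v : ℝ => v ^ 2) =o[nhds 0] fun v => v := by
      simpa using Asymptotics.isLittleO_pow_id (𝕜 := ℝ) one_lt_two
    simp only [sub_zero, smul_zero, max_self, ne_eq, OfNat.ofNat_ne_zero, not_false_eq_true,
      zero_pow]
    refine Asymptotics.IsBigO.trans_isLittleO (.of_bound 1 (.of_forall fun v => ?_)) h2
    rw [one_mul, norm_pow, norm_pow]
    gcongr
    rw [Real.norm_eq_abs, Real.norm_eq_abs, abs_of_nonneg (le_max_left _ _)]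
    exact max_le (abs_nonneg v) (le_abs_self v)
  · rw [max_eq_right h.le]
    have := (hasDerivAt_pow 2 u)
    simp only [Nat.cast_ofNat, Nat.add_one_sub_one, pow_one] at this
    refine this.congr_of_eventuallyEq ?_
    filter_upwards [Ioi_mem_nhds h] with v hv
    simp [max_eq_right (le_of_lt (Set.mem_Ioi.1 hv))]

variable {d : ℕ}

lemma continuous_eval_euclidean (P : MvPolynomial (Fin d) ℝ) :
    Continuous fun y : EuclideanSpace ℝ (Fin d) => eval (fun i => y i) P :=
  (MvPolynomial.continuous_eval P).comp (by fun_prop)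

lemma continuous_eval_sphere (P : MvPolynomial (Fin d) ℝ) :
    Continuous fun y : Sph d => eval (fun i => (y : EuclideanSpace ℝ (Fin d)) i) P :=
  (continuous_eval_euclidean P).comp continuous_subtype_val

lemma eval_smul_of_isHomogeneous {P : MvPolynomial (Fin d) ℝ} {n : ℕ} (hP : P.IsHomogeneous n)
    (r : ℝ) (y : Fin d → ℝ) : eval (fun i => r * y i) P = r ^ n * eval y P := by
  rw [eval_eq, eval_eq, Finset.mul_sum]
  refine Finset.sum_congr rfl fun m hm => ?_
  have := hP (mem_support_iff.1 hm)
  simp only [mul_pow, Finset.prod_mul_distrib, Finset.prod_pow_eq_pow_sum]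
  rw [← this, Finsupp.weight_apply, Finsupp.sum]
  simp
  ring

lemma hasLineDerivAt_eval (P : MvPolynomial (Fin d) ℝ) (i : Fin d)
    (y : EuclideanSpace ℝ (Fin d)) :
    HasLineDerivAt ℝ (fun y : EuclideanSpace ℝ (Fin d) => eval (fun j => y j) P)
      (eval (fun j => y j) (pderiv i P)) y (EuclideanSpace.single i 1) := by
  induction P using MvPolynomial.induction_on with
  | C a => simpa [HasLineDerivAt] using hasDerivAt_const (0 : ℝ) a
  | add P Q hP hQ => 
    have := HasDerivAt.add hP hQ
    simp only [HasLineDerivAt, map_add]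
    exact this
  | mul_X P j hP =>
    have hX : HasDerivAt (fun t : ℝ => (y + t • EuclideanSpace.single i (1 : ℝ)) j)
        (if i = j then 1 else 0) 0 := by
      have := ((hasDerivAt_id (0 : ℝ)).mul_const (if i = j then 1 else 0 : ℝ)).const_add (y j)
      simpa [Pi.single_apply, eq_comm] using this
    have := HasDerivAt.mul hP hX
    simp only [HasLineDerivAt, map_mul, eval_X]
    refine this.congr_deriv ?_
    rcases eq_or_ne i j with rfl | hij
    · simp [Derivation.leibniz]
      ring
    · simp [pderiv_X, Derivation.leibniz, hij, hij.symm]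
      ring

/-- The compactly supported radial weight used to pass from the sphere to the whole space. -/
def ballWeight (d : ℕ) (y : EuclideanSpace ℝ (Fin d)) : ℝ := max 0 (1 - ‖y‖ ^ 2)

lemma continuous_ballWeight : Continuous (ballWeight d) := by
  unfold ballWeight
  fun_prop

lemma hasCompactSupport_ballWeight : HasCompactSupport (ballWeight d) := by
  refine HasCompactSupport.of_support_subset_isCompact (isCompact_closedBall 0 1) fun y hy => ?_
  by_contra h
  refine hy ?_
  have : 1 < ‖y‖ := by simpa using h
  exact max_eq_left (by nlinarith)

lemma integrable_mul_ballWeight {F : EuclideanSpace ℝ (Fin d) → ℝ} (hF : Continuous F) :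
    Integrable fun y => F y * ballWeight d y :=
  (hF.mul continuous_ballWeight).integrable_of_hasCompactSupport
    hasCompactSupport_ballWeight.mul_left

lemma hasLineDerivAt_ballWeight_sq (i : Fin d) (y : EuclideanSpace ℝ (Fin d)) :
    HasLineDerivAt ℝ (fun y => ballWeight d y ^ 2) (-(4 * y i * ballWeight d y)) y
      (EuclideanSpace.single i 1) := by
  have h := hasLineDerivAt_eval (1 - normSqPoly d) i y
  have e (z : EuclideanSpace ℝ (Fin d)) :
      eval (fun j => z j) (1 - normSqPoly d) = 1 - ‖z‖ ^ 2 := by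
    simp [eval_normSqPoly, EuclideanSpace.real_norm_sq_eq]
  simp only [e] at h
  have h2 := HasDerivAt.comp (0 : ℝ) (hasDerivAt_max_zero_sq _) h
  simp only [zero_smul, add_zero] at h2
  unfold HasLineDerivAt
  refine h2.congr_deriv ?_
  rw [map_sub, pderiv_normSqPoly, Derivation.map_one_eq_zero]
  simp [ballWeight]
  ring

lemma integral_eval_pderiv_mul_ballWeight_sq (P : MvPolynomial (Fin d) ℝ) (i : Fin d) :
    ∫ y : EuclideanSpace ℝ (Fin d), eval (fun j => y j) (pderiv i P) * ballWeight d y ^ 2 =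
      4 * ∫ y : EuclideanSpace ℝ (Fin d), eval (fun j => y j) (X i * P) * ballWeight d y := by
  have := integral_bilinear_hasLineDerivAt_right_eq_neg_left_of_integrable
    (μ := (volume : Measure (EuclideanSpace ℝ (Fin d)))) (B := ContinuousLinearMap.mul ℝ ℝ)
    (f := fun y : EuclideanSpace ℝ (Fin d) => eval (fun j => y j) P)
    (g := fun y => ballWeight d y ^ 2)
    (f' := fun y => eval (fun j => y j) (pderiv i P))
    (g' := fun y => -(4 * y i * ballWeight d y)) (v := EuclideanSpace.single i 1)
    ?_ ?_ ?_ (fun y _ => hasLineDerivAt_eval P i y) (fun y _ => hasLineDerivAt_ballWeight_sq i y)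
  · simp only [ContinuousLinearMap.mul_apply'] at this
    rw [← integral_const_mul, ← neg_inj, ← this, ← integral_neg]
    congr 1 with y
    simp
    ring
  · simp only [ContinuousLinearMap.mul_apply', pow_two, ← mul_assoc]
    exact integrable_mul_ballWeight ((continuous_eval_euclidean _).mul continuous_ballWeight)
  · simp only [ContinuousLinearMap.mul_apply', ← neg_mul, ← mul_assoc]
    have h4 : Continuous fun y : EuclideanSpace ℝ (Fin d) => -4 * y i := by fun_prop
    have h5 := integrable_mul_ballWeight ((continuous_eval_euclidean P).mul h4)
    simp only [Pi.mul_apply, mul_assoc] at h5 ⊢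
    exact h5
  · simp only [ContinuousLinearMap.mul_apply', pow_two, ← mul_assoc]
    exact integrable_mul_ballWeight ((continuous_eval_euclidean _).mul continuous_ballWeight)

lemma integral_mul_ballWeight_eq_zero {P Q : MvPolynomial (Fin d) ℝ} {m k : ℕ} (hmk : m ≠ k)
    (hP : P.IsHomogeneous m) (hQ : Q.IsHomogeneous k) (hP0 : polyLaplacian d P = 0)
    (hQ0 : polyLaplacian d Q = 0) :
    ∫ y : EuclideanSpace ℝ (Fin d), eval (fun j => y j) (P * Q) * ballWeight d y = 0 := by
  have h1 : ∑ i, pderiv i (P * pderiv i Q - Q * pderiv i P) = 0 := by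
    have : ∑ i, pderiv i (P * pderiv i Q - Q * pderiv i P) =
        P * polyLaplacian d Q - Q * polyLaplacian d P := by
      simp only [polyLaplacian_apply, Finset.mul_sum, ← Finset.sum_sub_distrib]
      refine Finset.sum_congr rfl fun i _ => ?_
      simp only [Derivation.leibniz, smul_eq_mul, map_sub]
      ring
    rw [this, hP0, hQ0]
    simp
  have h2 : ∑ i, X i * (P * pderiv i Q - Q * pderiv i P) = C (k - m : ℝ) * (P * Q) := by
    have e1 := hP.sum_X_mul_pderiv
    have e2 := hQ.sum_X_mul_pderiv
    have : ∑ i, X i * (P * pderiv i Q - Q * pderiv i P) =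
        P * ∑ i, X i * pderiv i Q - Q * ∑ i, X i * pderiv i P := by
      simp only [Finset.mul_sum, ← Finset.sum_sub_distrib]
      exact Finset.sum_congr rfl fun i _ => by ring
    rw [this, e1, e2]
    simp only [nsmul_eq_mul, map_sub, map_natCast]
    ring
  have h3 := Finset.sum_congr (rfl : (Finset.univ : Finset (Fin d)) = Finset.univ) fun i _ =>
    integral_eval_pderiv_mul_ballWeight_sq (P * pderiv i Q - Q * pderiv i P) i
  rw [← Finset.mul_sum, ← integral_finsetSum, ← integral_finsetSum] at h3
  · simp only [← Finset.sum_mul, ← map_sum, h1, h2] at h3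
    simp only [map_zero, zero_mul, integral_zero, map_mul (eval _) (C _), eval_C, mul_assoc,
      integral_const_mul] at h3
    have : (k - m : ℝ) ≠ 0 := sub_ne_zero.2 (by exact_mod_cast hmk.symm)
    simpa [this] using h3.symm
  · exact fun i _ => integrable_mul_ballWeight (continuous_eval_euclidean _)
  · intro i _
    simp only [pow_two, ← mul_assoc]
    exact integrable_mul_ballWeight ((continuous_eval_euclidean _).mul continuous_ballWeight)

/-- Spherical harmonics of different degrees are orthogonal. -/
lemma integral_sphere_mul_eq_zero (hd : 3 ≤ d) {P Q : MvPolynomial (Fin d) ℝ} {m k : ℕ}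
    (hmk : m ≠ k) (hP : P.IsHomogeneous m) (hQ : Q.IsHomogeneous k)
    (hP0 : polyLaplacian d P = 0) (hQ0 : polyLaplacian d Q = 0) :
    ∫ y : Sph d, eval (fun j => (y : EuclideanSpace ℝ (Fin d)) j) (P * Q) ∂sphMeasure d = 0 := by
  have : Nonempty (Fin d) := ⟨⟨0, by omega⟩⟩
  have h1 := integral_eq_toSphere_mul (volume : Measure (EuclideanSpace ℝ (Fin d)))
    (F := fun y => eval (fun j => y j) (P * Q) * ballWeight d y)
    (g := fun y => eval (fun j => (y : EuclideanSpace ℝ (Fin d)) j) (P * Q))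
    (h := fun r => r ^ (m + k) * max 0 (1 - r ^ 2)) (fun s r hr => by
      have := eval_smul_of_isHomogeneous (hP.mul hQ) r (fun j => (s : EuclideanSpace ℝ (Fin d)) j)
      simp only [PiLp.smul_apply, smul_eq_mul, this, ballWeight, norm_smul, norm_eq_of_mem_sphere,
        mul_one, Real.norm_eq_abs, sq_abs]
      ring)
  have h2 := integral_eq_toSphere_mul (volume : Measure (EuclideanSpace ℝ (Fin d)))
    (F := fun y => ‖y‖ ^ (m + k) * ballWeight d y) (g := fun _ => 1)
    (h := fun r => r ^ (m + k) * max 0 (1 - r ^ 2)) (fun s r hr => by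
      simp [ballWeight, norm_smul, abs_of_pos hr])
  rw [integral_mul_ballWeight_eq_zero hmk hP hQ hP0 hQ0] at h1
  have h3 : 0 < ∫ y : EuclideanSpace ℝ (Fin d), ‖y‖ ^ (m + k) * ballWeight d y := by
    refine Continuous.integral_pos_of_hasCompactSupport_nonneg_nonzero
      (x := EuclideanSpace.single ⟨0, by omega⟩ (1 / 2))
      (((continuous_norm.pow _).mul continuous_ballWeight)) 
      hasCompactSupport_ballWeight.mul_left
      (fun y => mul_nonneg (by positivity) (le_max_left _ _)) ?_
    simp [ballWeight]
    norm_num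
  rw [h2] at h3
  exact (mul_eq_zero.1 h1.symm).resolve_right (right_ne_zero_of_mul h3.ne')

end Orthogonality

section ReproducingKernel

open MvPolynomial

variable {d : ℕ}

lemma cCoef_pos (hd : 3 ≤ d) (n : ℕ) : 0 < cCoef d n := by
  have h3 : (3 : ℝ) ≤ d := by exact_mod_cast hd
  have hn : (0 : ℝ) ≤ n := Nat.cast_nonneg _
  have h1 := Real.Gamma_pos_of_pos (show (0 : ℝ) < d / 2 by linarith)
  have h2 := Real.Gamma_pos_of_pos (show (0 : ℝ) < d + n - 1 by linarith)
  have h4 := Real.Gamma_pos_of_pos (show (0 : ℝ) < n + 1 by linarith)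
  have h5 := Real.Gamma_pos_of_pos (show (0 : ℝ) < d - 1 by linarith)
  have h6 : (0 : ℝ) < d + 2 * n - 2 := by linarith
  have h7 : (0 : ℝ) < d + n - 2 := by linarith
  unfold cCoef
  positivity

lemma cCoef_succ (hd : 3 ≤ d) (n : ℕ) :
    cCoef d (n + 1) * ((2 * n + (d - 2)) * (n + 1)) =
      cCoef d n * ((n + (d - 2)) * (d + 2 * n)) := by
  have h3 : (3 : ℝ) ≤ d := by exact_mod_cast hd
  have hn : (0 : ℝ) ≤ n := Nat.cast_nonneg _
  have h4 := Real.Gamma_pos_of_pos (show (0 : ℝ) < n + 1 by linarith)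
  have h5 := Real.Gamma_pos_of_pos (show (0 : ℝ) < d - 1 by linarith)
  have h7 : (d + n - 2 : ℝ) ≠ 0 := by linarith
  have h8 : (d + n - 1 : ℝ) ≠ 0 := by linarith
  have h9 : (n + 1 : ℝ) ≠ 0 := by linarith
  have e1 : Real.Gamma (d + (n + 1 : ℕ) - 1) = (d + n - 1) * Real.Gamma (d + n - 1) := by
    rw [← Real.Gamma_add_one h8]
    push_cast
    ring_nf
  have e2 : Real.Gamma ((n + 1 : ℕ) + 1) = (n + 1) * Real.Gamma (n + 1) := by
    rw [← Real.Gamma_add_one h9]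
    push_cast
    ring_nf
  have e3 : (d + (n + 1 : ℕ) - 2 : ℝ) = d + n - 1 := by push_cast; ring
  have e4 : (d + 2 * (n + 1 : ℕ) - 2 : ℝ) = d + 2 * n := by push_cast; ring
  unfold cCoef
  rw [e1, e2, e3, e4]
  field_simp
  ring

lemma exists_cCoef_le (hd : 3 ≤ d) :
    ∃ C : ℝ, 0 < C ∧ ∀ n : ℕ, 1 ≤ n → cCoef d n ≤ C * (n : ℝ) ^ (d - 2) := by
  have h3 : (3 : ℝ) ≤ d := by exact_mod_cast hd
  have h1 := Real.Gamma_pos_of_pos (show (0 : ℝ) < d / 2 by linarith)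
  have h5 := Real.Gamma_pos_of_pos (show (0 : ℝ) < d - 1 by linarith)
  refine ⟨Real.Gamma (d / 2) / (2 * Real.pi ^ ((d : ℝ) / 2)) * 2 *
    ((d : ℝ) ^ (d - 2) / Real.Gamma (d - 1)), by positivity, fun n hn => ?_⟩
  have hn' : (1 : ℝ) ≤ n := by exact_mod_cast hn
  have h4 := Real.Gamma_pos_of_pos (show (0 : ℝ) < n + 1 by linarith)
  have hG : Real.Gamma (d + n - 1) ≤ Real.Gamma (n + 1) * ((d : ℝ) * n) ^ (d - 2) := by
    have e1 : (d + n - 1 : ℝ) = (n + (d - 2) : ℕ) + 1 := by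
      push_cast [Nat.cast_sub (show 2 ≤ d by omega)]
      ring
    rw [e1, Real.Gamma_nat_eq_factorial, Real.Gamma_nat_eq_factorial,
      ← Nat.factorial_mul_ascFactorial]
    have : (n + 1).ascFactorial (d - 2) ≤ (d * n) ^ (d - 2) := by
      refine (Nat.ascFactorial_le_pow_add _ _).trans (Nat.pow_le_pow_left ?_ _)
      obtain ⟨e, rfl⟩ : ∃ e, d = e + 3 := ⟨d - 3, by omega⟩
      have : e + 3 - 2 = e + 1 := by omega
      rw [this]
      nlinarith
    push_cast
    gcongr
    exact_mod_cast this
  have hq : (d + 2 * n - 2 : ℝ) / (d + n - 2) ≤ 2 := by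
    rw [div_le_iff₀ (by linarith)]
    linarith
  have hq0 : 0 < (d + n - 2 : ℝ) := by linarith
  have hr : Real.Gamma (d + n - 1) / (Real.Gamma (n + 1) * Real.Gamma (d - 1)) ≤
      (d : ℝ) ^ (d - 2) / Real.Gamma (d - 1) * (n : ℝ) ^ (d - 2) := by
    rw [div_le_iff₀ (by positivity)]
    refine hG.trans (le_of_eq ?_)
    rw [mul_pow]
    field_simp
  have hG0 := Real.Gamma_pos_of_pos (show (0 : ℝ) < d + n - 1 by linarith)
  unfold cCoef
  rw [mul_assoc _ _ ((n : ℝ) ^ (d - 2))]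
  gcongr

lemma integrable_eval_sphere (P : MvPolynomial (Fin d) ℝ) :
    Integrable (fun y : Sph d => eval (fun j => (y : EuclideanSpace ℝ (Fin d)) j) P)
      (sphMeasure d) := by
  unfold sphMeasure
  exact (continuous_eval_sphere P).integrable_of_hasCompactSupport
    (HasCompactSupport.of_compactSpace _)

/-- The integral of a polynomial over the sphere. -/
def sphIntegral (d : ℕ) : MvPolynomial (Fin d) ℝ →ₗ[ℝ] ℝ where
  toFun P := ∫ y : Sph d, eval (fun j => (y : EuclideanSpace ℝ (Fin d)) j) P ∂sphMeasure d
  map_add' P Q := by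
    simp only [map_add]
    exact integral_add (integrable_eval_sphere P) (integrable_eval_sphere Q)
  map_smul' a P := by
    simp only [smul_eval, integral_const_mul, RingHom.id_apply, smul_eq_mul]

lemma sphIntegral_apply (P : MvPolynomial (Fin d) ℝ) : sphIntegral d P =
    ∫ y : Sph d, eval (fun j => (y : EuclideanSpace ℝ (Fin d)) j) P ∂sphMeasure d := rfl

lemma sum_sq_eq_one (y : Sph d) : ∑ i, (y : EuclideanSpace ℝ (Fin d)) i ^ 2 = 1 := by
  rw [← EuclideanSpace.real_norm_sq_eq, norm_eq_of_mem_sphere, one_pow]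

lemma sphIntegral_normSqPoly_mul (P : MvPolynomial (Fin d) ℝ) :
    sphIntegral d (normSqPoly d * P) = sphIntegral d P := by
  simp only [sphIntegral_apply, map_mul, eval_normSqPoly, sum_sq_eq_one, one_mul]

lemma sphIntegral_C_mul (a : ℝ) (P : MvPolynomial (Fin d) ℝ) :
    sphIntegral d (C a * P) = a * sphIntegral d P := by
  rw [← smul_eq_C_mul, map_smul, smul_eq_mul]

/-- Integration against `zonalPoly x n` evaluates spherical harmonics of degree `n` at `x`, up to
the factor `c_0 σ(S) / c_n`. -/
lemma sphIntegral_zonalPoly_mul (hd : 3 ≤ d) {x : Fin d → ℝ} (hx : ∑ i, x i ^ 2 = 1) (n : ℕ)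
    {Y : MvPolynomial (Fin d) ℝ} (hY : Y.IsHomogeneous n) (hY0 : polyLaplacian d Y = 0) :
    sphIntegral d (zonalPoly x n * Y) =
      (sphMeasure d).real Set.univ * cCoef d 0 / cCoef d n * eval x Y := by
  have h3 : (3 : ℝ) ≤ d := by exact_mod_cast hd
  induction n generalizing Y with
  | zero =>
    obtain ⟨a, rfl⟩ : ∃ a, Y = C a := ⟨_, (totalDegree_eq_zero_iff_eq_C).1
      (Nat.le_zero.1 hY.totalDegree_le)⟩
    have := (cCoef_pos hd 0).ne'
    simp only [zonalPoly, one_mul, sphIntegral_apply, eval_C, integral_const, smul_eq_mul]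
    field_simp
  | succ n ih =>
    have hn : (0 : ℝ) ≤ n := Nat.cast_nonneg _
    have h1 : (n + (d - 2) : ℝ) ≠ 0 := by linarith
    have h2 : (d + 2 * n : ℝ) ≠ 0 := by linarith
    have hrec : (n + (d - 2) : ℝ) * sphIntegral d (zonalPoly x (n + 1) * Y) =
        (2 * n + (d - 2) : ℝ) * sphIntegral d (zonalPoly x n * (linForm x * Y)) := by
      rw [← sphIntegral_C_mul, ← sphIntegral_C_mul]
      rcases n with _ | n
      · simp [zonalPoly]
      · have hz := zonalPoly_rec x hd n
        have ho : sphIntegral d (zonalPoly x n * Y) = 0 :=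
          integral_sphere_mul_eq_zero hd (by omega) (isHomogeneous_zonalPoly x n) hY
            (polyLaplacian_zonalPoly x hd hx n) hY0
        have : C (↑(n + 1) + (d - 2) : ℝ) * (zonalPoly x (n + 2) * Y) =
            C (2 * ↑(n + 1) + (d - 2) : ℝ) * (zonalPoly x (n + 1) * (linForm x * Y)) -
              C (n + 1 : ℝ) * (normSqPoly d * (zonalPoly x n * Y)) := by
          push_cast
          linear_combination Y * hz
        rw [this, map_sub, sphIntegral_C_mul _ (normSqPoly d * _), sphIntegral_normSqPoly_mul, ho,
          mul_zero, sub_zero]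
    have hH := polyLaplacian_linForm_mul_sub x hd hY hY0
    have hHh : (linForm x * Y -
        C (1 / (d + 2 * n) : ℝ) * (normSqPoly d * dirDeriv x Y)).IsHomogeneous (n + 2) := by
      refine IsHomogeneous.sub ?_ (isHomogeneous_C_mul' _ ?_)
      · have := (isHomogeneous_linForm x).mul hY
        rwa [show 1 + (n + 1) = n + 2 by ring] at this
      · have := isHomogeneous_normSqPoly.mul (isHomogeneous_dirDeriv x hY)
        rwa [Nat.add_sub_cancel, show 2 + n = n + 2 by ring] at this
    have ho : sphIntegral d (zonalPoly x n * (linForm x * Y -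
        C (1 / (d + 2 * n) : ℝ) * (normSqPoly d * dirDeriv x Y))) = 0 :=
      integral_sphere_mul_eq_zero hd (by omega) (isHomogeneous_zonalPoly x n) hHh
        (polyLaplacian_zonalPoly x hd hx n) hH
    have hdY : polyLaplacian d (dirDeriv x Y) = 0 := by
      rw [dirDeriv_polyLaplacian_comm, hY0, map_zero]
    have hi := ih (isHomogeneous_dirDeriv x hY) hdY
    rw [eval_dirDeriv_self x hY] at hi
    rw [mul_sub, map_sub, sub_eq_zero, mul_left_comm _ (C _), sphIntegral_C_mul,
      mul_left_comm _ (normSqPoly d), sphIntegral_normSqPoly_mul, hi] at ho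
    rw [ho] at hrec
    refine mul_left_cancel₀ h1 (hrec.trans ?_)
    have hc := cCoef_succ hd n
    have hc1 := (cCoef_pos hd (n + 1)).ne'
    have hc2 := (cCoef_pos hd n).ne'
    push_cast
    field_simp
    linear_combination ((sphMeasure d).real Set.univ * cCoef d 0 * eval x Y) * hc

end ReproducingKernel

section KernelBound

open MvPolynomial intervalIntegral

/-- The base of the Laplace integral representation of Gegenbauer polynomials. -/
def laplaceBase (t a φ : ℝ) : ℂ := t + Complex.I * a * Real.cos φ

lemma continuous_laplaceBase (t a : ℝ) : Continuous (laplaceBase t a) := by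
  unfold laplaceBase
  fun_prop

/-- The Laplace integral of degree `n`. -/
def laplaceIntegral (k : ℕ) (t a : ℝ) (n : ℕ) : ℂ :=
  ∫ φ in (0 : ℝ)..Real.pi, laplaceBase t a φ ^ n * (Real.sin φ : ℂ) ^ k

lemma continuous_laplace_integrand (k : ℕ) (t a : ℝ) (n : ℕ) :
    Continuous fun φ : ℝ => laplaceBase t a φ ^ n * (Real.sin φ : ℂ) ^ k := by
  have := continuous_laplaceBase t a
  fun_prop

lemma laplaceBase_sq {t a : ℝ} (ha : t ^ 2 + a ^ 2 = 1) (φ : ℝ) :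
    laplaceBase t a φ ^ 2 - 2 * t * laplaceBase t a φ + 1 = a ^ 2 * (Real.sin φ : ℂ) ^ 2 := by
  have h1 : (t ^ 2 + a ^ 2 : ℂ) = 1 := by exact_mod_cast ha
  have h2 : ((Real.sin φ : ℂ)) ^ 2 + (Real.cos φ : ℂ) ^ 2 = 1 := by
    exact_mod_cast Real.sin_sq_add_cos_sq φ
  unfold laplaceBase
  linear_combination (a ^ 2 * (Real.cos φ : ℂ) ^ 2) * Complex.I_sq - h1 - a ^ 2 * h2

lemma laplaceIntegral_rec (k : ℕ) {t a : ℝ} (ha : t ^ 2 + a ^ 2 = 1) (n : ℕ) :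
    (n + (k + 1)) * laplaceIntegral k t a (n + 1) =
      (2 * n + (k + 1)) * (t * laplaceIntegral k t a n) - n * laplaceIntegral k t a (n - 1) := by
  have hu (φ : ℝ) : HasDerivAt (laplaceBase t a) (-(Complex.I * a * Real.sin φ)) φ := by
    have := ((Real.hasDerivAt_cos φ).ofReal_comp.const_mul (Complex.I * a)).const_add (t : ℂ)
    refine this.congr_deriv ?_
    push_cast
    ring
  have hG (φ : ℝ) : HasDerivAt
      (fun φ : ℝ => Complex.I * a * (laplaceBase t a φ ^ n * (Real.sin φ : ℂ) ^ (k + 1)))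
      ((n + (k + 1)) * (laplaceBase t a φ ^ (n + 1) * (Real.sin φ : ℂ) ^ k) -
        (2 * n + (k + 1)) * (t * (laplaceBase t a φ ^ n * (Real.sin φ : ℂ) ^ k)) +
        n * (laplaceBase t a φ ^ (n - 1) * (Real.sin φ : ℂ) ^ k)) φ := by
    have := (((hu φ).pow n).mul ((Real.hasDerivAt_sin φ).ofReal_comp.pow (k + 1))).const_mul
      (Complex.I * a)
    refine this.congr_deriv ?_
    have hs := laplaceBase_sq ha φ
    have hc : Complex.I * a * Real.cos φ = laplaceBase t a φ - t := by
      unfold laplaceBase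
      ring
    simp only [Nat.add_sub_cancel, Pi.pow_apply]
    rcases n with _ | n
    · simp only [Nat.cast_zero, pow_zero, zero_mul, zero_add, mul_zero, one_mul, add_zero, pow_one]
      push_cast [-Complex.ofReal_sin, -Complex.ofReal_cos]
      linear_combination (k + 1) * (Real.sin φ : ℂ) ^ k * hc
    · simp only [Nat.add_sub_cancel]
      push_cast [-Complex.ofReal_sin, -Complex.ofReal_cos]
      linear_combination (k + 1) * laplaceBase t a φ ^ (n + 1) * (Real.sin φ : ℂ) ^ k * hc -
        (n + 1) * laplaceBase t a φ ^ n * (Real.sin φ : ℂ) ^ k * hs -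
        (n + 1) * laplaceBase t a φ ^ n * (Real.sin φ : ℂ) ^ (k + 2) * a ^ 2 * Complex.I_sq
  have hI (j : ℕ) := (continuous_laplace_integrand k t a j).intervalIntegrable 0 Real.pi
    (μ := volume)
  have h := integral_eq_sub_of_hasDerivAt (a := 0) (b := Real.pi) (fun φ _ => hG φ)
    ((((hI (n + 1)).const_mul _).sub (((hI n).const_mul _).const_mul _)).add
      ((hI (n - 1)).const_mul _))
  rw [integral_add (((hI (n + 1)).const_mul _).sub (((hI n).const_mul _).const_mul _))
      ((hI (n - 1)).const_mul _),
    integral_sub ((hI (n + 1)).const_mul _) (((hI n).const_mul _).const_mul _)] at h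
  simp only [intervalIntegral.integral_const_mul] at h
  simp only [Real.sin_pi, Real.sin_zero, Complex.ofReal_zero, ne_eq, Nat.add_eq_zero_iff,
    one_ne_zero, and_false, not_false_eq_true, zero_pow, mul_zero, sub_self] at h
  unfold laplaceIntegral
  linear_combination h

/-- The Laplace integral representation of zonal harmonics. -/
lemma eval_zonalPoly_mul {d : ℕ} (hd : 3 ≤ d) {x y : Fin d → ℝ} (hy : ∑ i, y i ^ 2 = 1) {a : ℝ}
    (ha : (∑ i, x i * y i) ^ 2 + a ^ 2 = 1) (n : ℕ) :
    (eval y (zonalPoly x n) : ℂ) * laplaceIntegral (d - 3) (∑ i, x i * y i) a 0 =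
      laplaceIntegral (d - 3) (∑ i, x i * y i) a n := by
  have hk : ((d - 3 : ℕ) : ℂ) + 1 = d - 2 := by
    push_cast [Nat.cast_sub hd]
    ring
  induction n using Nat.twoStepInduction with
  | zero => simp [zonalPoly]
  | one =>
    have h := laplaceIntegral_rec (d - 3) ha 0
    have h0 : ((d - 3 : ℕ) : ℂ) + 1 ≠ 0 := by exact_mod_cast Nat.succ_ne_zero (d - 3)
    refine mul_left_cancel₀ h0 ?_
    simp only [Nat.cast_zero, zero_add, zero_mul, mul_zero, sub_zero] at h
    rw [h, zonalPoly, eval_linForm]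
  | more n h0 h1 =>
    have h := laplaceIntegral_rec (d - 3) ha (n + 1)
    have hz := congrArg (fun r : ℝ => (r : ℂ)) (congrArg (eval y) (zonalPoly_rec x hd n))
    simp only [map_mul, map_sub, eval_C, eval_linForm, eval_normSqPoly, hy] at hz
    rw [Nat.add_sub_cancel, hk, ← h0, ← h1] at h
    have h2 : ((n + 1 : ℕ) : ℂ) + (d - 2) ≠ 0 := by
      rw [← hk]
      exact_mod_cast Nat.succ_ne_zero (n + 1 + (d - 3))
    refine mul_left_cancel₀ h2 ?_
    rw [h]
    push_cast at hz ⊢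
    linear_combination laplaceIntegral (d - 3) (∑ i, x i * y i) a 0 * hz

lemma norm_laplaceBase_le {t a : ℝ} (ha : t ^ 2 + a ^ 2 = 1) (φ : ℝ) :
    ‖laplaceBase t a φ‖ ≤ Real.exp (-(a ^ 2 * Real.sin φ ^ 2 / 2)) := by
  have h : ‖laplaceBase t a φ‖ ^ 2 = 1 - a ^ 2 * Real.sin φ ^ 2 := by
    rw [← Complex.normSq_eq_norm_sq, Complex.normSq_apply]
    simp [laplaceBase, -Complex.ofReal_cos]
    have := Real.sin_sq_add_cos_sq φ
    linear_combination ha + a ^ 2 * this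
  refine le_of_pow_le_pow_left₀ two_ne_zero (Real.exp_pos _).le ?_
  rw [h, ← Real.exp_nat_mul]
  refine (Real.one_sub_le_exp_neg _).trans (le_of_eq ?_)
  congr 1
  push_cast
  ring

lemma norm_one_sub_laplaceBase_sq_le {t a : ℝ} (ha : t ^ 2 + a ^ 2 = 1) (ha0 : 0 ≤ a) (φ : ℝ) :
    ‖1 - laplaceBase t a φ ^ 2‖ ≤ 4 * a := by
  have ht : |t| ≤ 1 := abs_le_one_iff_mul_self_le_one.2 (by nlinarith)
  have ha1 : |a| ≤ 1 := abs_le_one_iff_mul_self_le_one.2 (by nlinarith)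
  have hc := Real.abs_cos_le_one φ
  have h1 : (t ^ 2 + a ^ 2 : ℂ) = 1 := by exact_mod_cast ha
  have e : 1 - laplaceBase t a φ ^ 2 =
      a * (a + a * Real.cos φ ^ 2 - 2 * t * Real.cos φ * Complex.I) := by
    unfold laplaceBase
    linear_combination -h1 - (a ^ 2 * (Real.cos φ : ℂ) ^ 2) * Complex.I_sq
  rw [e, norm_mul, Complex.norm_real, Real.norm_eq_abs, abs_of_nonneg ha0, mul_comm]
  refine mul_le_mul_of_nonneg_right ?_ ha0
  calc _ ≤ ‖(a : ℂ)‖ + ‖(a * Real.cos φ ^ 2 : ℂ)‖ + ‖(2 * t * Real.cos φ * Complex.I : ℂ)‖ :=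
        (norm_sub_le _ _).trans (by gcongr; exact norm_add_le _ _)
    _ = |a| + |a| * |Real.cos φ| ^ 2 + 2 * |t| * |Real.cos φ| := by
        simp [-Complex.ofReal_cos, Complex.norm_real]
    _ ≤ 1 + 1 * 1 ^ 2 + 2 * 1 * 1 := by gcongr
    _ = 4 := by norm_num

lemma sin_pow_mul_exp_le (k : ℕ) {c φ : ℝ} (hc : 0 ≤ c) (h0 : 0 ≤ φ) (h1 : φ ≤ Real.pi / 2) :
    Real.sin φ ^ k * Real.exp (-(c * Real.sin φ ^ 2 / 2)) ≤
      φ ^ k * Real.exp (-(2 * c / Real.pi ^ 2) * φ ^ 2) := by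
  have hs := Real.mul_le_sin h0 h1
  have hs0 : 0 ≤ Real.sin φ := (by positivity : (0 : ℝ) ≤ 2 / Real.pi * φ).trans hs
  gcongr
  · exact Real.sin_le h0
  · have : (2 / Real.pi * φ) ^ 2 ≤ Real.sin φ ^ 2 := by gcongr
    have h2 := mul_le_mul_of_nonneg_left this hc
    have : 2 * c / Real.pi ^ 2 * φ ^ 2 = c * (2 / Real.pi * φ) ^ 2 / 2 := by
      field_simp
    linarith

lemma integral_sin_pow_mul_exp_le (k : ℕ) {c : ℝ} (hc : 0 < c) :
    ∫ φ in (0 : ℝ)..Real.pi, Real.sin φ ^ k * Real.exp (-(c * Real.sin φ ^ 2 / 2)) ≤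
      (2 * c / Real.pi ^ 2) ^ (-((k : ℝ) + 1) / 2) * Real.Gamma (((k : ℝ) + 1) / 2) := by
  set g : ℝ → ℝ := fun φ => φ ^ k * Real.exp (-(2 * c / Real.pi ^ 2) * φ ^ 2) with hg
  have hgc : Continuous g := by
    rw [hg]
    fun_prop
  have hb : 0 < 2 * c / Real.pi ^ 2 := by positivity
  have hI : ∫ φ in Set.Ioi (0 : ℝ), g φ =
      (2 * c / Real.pi ^ 2) ^ (-((k : ℝ) + 1) / 2) * (1 / 2) *
        Real.Gamma (((k : ℝ) + 1) / 2) := by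
    rw [← integral_rpow_mul_exp_neg_mul_rpow two_pos (by linarith [k.cast_nonneg (α := ℝ)]) hb]
    simp [hg]
  have hint : IntegrableOn g (Set.Ioi 0) := by
    have := integrableOn_rpow_mul_exp_neg_mul_sq hb
      (show (-1 : ℝ) < k by linarith [k.cast_nonneg (α := ℝ)])
    simpa [hg] using this
  have hle : ∫ φ in (0 : ℝ)..Real.pi, g φ ≤ ∫ φ in Set.Ioi (0 : ℝ), g φ := by
    rw [integral_of_le Real.pi_pos.le]
    refine setIntegral_mono_set hint ?_ (Filter.Eventually.of_forall fun φ hφ => hφ.1)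
    filter_upwards [ae_restrict_mem measurableSet_Ioi] with φ hφ
    have : 0 < φ := hφ
    simp only [hg, Pi.zero_apply]
    positivity
  have hrefl : ∫ φ in (0 : ℝ)..Real.pi, g (Real.pi - φ) = ∫ φ in (0 : ℝ)..Real.pi, g φ := by
    simp
  calc
    _ ≤ ∫ φ in (0 : ℝ)..Real.pi, (g φ + g (Real.pi - φ)) := by
      refine integral_mono_on Real.pi_pos.le (Continuous.intervalIntegrable (by fun_prop) _ _)
        (Continuous.intervalIntegrable (by fun_prop) _ _) fun φ hφ => ?_
      have hg0 (ψ : ℝ) (h : 0 ≤ ψ) : 0 ≤ g ψ := by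
        simp only [hg]
        positivity
      rcases le_total φ (Real.pi / 2) with h | h
      · have := sin_pow_mul_exp_le k hc.le hφ.1 h
        linarith [hg0 (Real.pi - φ) (sub_nonneg.2 hφ.2)]
      · have := sin_pow_mul_exp_le k hc.le (sub_nonneg.2 hφ.2)
          (show Real.pi - φ ≤ Real.pi / 2 by linarith)
        rw [Real.sin_pi_sub] at this
        linarith [hg0 φ hφ.1]
    _ = 2 * ∫ φ in (0 : ℝ)..Real.pi, g φ := by
      rw [integral_add (hgc.intervalIntegrable _ _)
        (Continuous.intervalIntegrable (by fun_prop) _ _), hrefl]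
      ring
    _ ≤ 2 * ∫ φ in Set.Ioi (0 : ℝ), g φ := by gcongr
    _ = _ := by
      rw [hI]
      ring

lemma sum_laplaceIntegral (k m : ℕ) (t a : ℝ) (n : ℕ) :
    ∑ j ∈ Finset.range (m + 1), (-1 : ℂ) ^ j * (m.choose j) * laplaceIntegral k t a (n + 2 * j) =
      ∫ φ in (0 : ℝ)..Real.pi, laplaceBase t a φ ^ n * (1 - laplaceBase t a φ ^ 2) ^ m *
        (Real.sin φ : ℂ) ^ k := by
  simp only [laplaceIntegral, ← intervalIntegral.integral_const_mul]
  rw [← intervalIntegral.integral_finsetSum]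
  · refine integral_congr fun φ _ => ?_
    rw [sub_eq_neg_add, add_pow, Finset.mul_sum, Finset.sum_mul]
    refine Finset.sum_congr rfl fun j _ => ?_
    rw [neg_pow, one_pow]
    ring
  · exact fun j _ => ((continuous_laplace_integrand k t a _).const_mul _).intervalIntegrable _ _

/-- The zonal differences appearing in the kernel of the operator decay like `n ^ (-λ)`. -/
lemma exists_abs_sum_zonalPoly_le {d : ℕ} (hd : 3 ≤ d) :
    ∃ C : ℝ, 0 < C ∧ ∀ n : ℕ, 1 ≤ n → ∀ x y : Fin d → ℝ, ∑ i, x i ^ 2 = 1 → ∑ i, y i ^ 2 = 1 →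
      |∑ j ∈ Finset.range (d - 1), (-1 : ℝ) ^ j * ((d - 2).choose j) *
        eval y (zonalPoly x (n + 2 * j))| ≤ C * (n : ℝ) ^ (-(((d : ℝ) - 2) / 2)) := by
  obtain ⟨k, rfl⟩ : ∃ k, d = k + 3 := ⟨d - 3, by omega⟩
  have hW : 0 < ∫ φ in (0 : ℝ)..Real.pi, Real.sin φ ^ k := integral_sin_pow_pos k
  set W := ∫ φ in (0 : ℝ)..Real.pi, Real.sin φ ^ k with hWdef
  have hΓ := Real.Gamma_pos_of_pos (show (0 : ℝ) < ((k : ℝ) + 1) / 2 by positivity)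
  refine ⟨4 ^ (k + 1) * ((2 / Real.pi ^ 2) ^ (-((k : ℝ) + 1) / 2) *
    Real.Gamma (((k : ℝ) + 1) / 2)) / W, by positivity, fun n hn x y hx hy => ?_⟩
  have hn0 : (0 : ℝ) < n := by exact_mod_cast hn
  have ht : (∑ i, x i * y i) ^ 2 ≤ 1 := by
    have := Finset.sum_mul_sq_le_sq_mul_sq Finset.univ x y
    rwa [hx, hy, one_mul] at this
  set t := ∑ i, x i * y i with htdef
  set a := √(1 - t ^ 2) with hadef
  have ha : t ^ 2 + a ^ 2 = 1 := by
    rw [hadef, Real.sq_sqrt (by linarith)]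
    ring
  have ha0 : 0 ≤ a := Real.sqrt_nonneg _
  have hz (n : ℕ) := eval_zonalPoly_mul hd (x := x) (y := y) hy ha n
  simp only [← htdef, Nat.add_sub_cancel] at hz
  have hL0 : laplaceIntegral k t a 0 = W := by
    simp only [laplaceIntegral, pow_zero, one_mul, hWdef, ← intervalIntegral.integral_ofReal]
    simp
  rw [hL0] at hz
  have hsum := sum_laplaceIntegral k (k + 1) t a n
  simp only [← hz, ← mul_assoc, ← Finset.sum_mul] at hsum
  rw [show k + 3 - 1 = k + 1 + 1 by omega, show k + 3 - 2 = k + 1 by omega,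
    show -((((k + 3 : ℕ) : ℝ) - 2) / 2) = -((k : ℝ) + 1) / 2 by push_cast; ring]
  set S := ∑ j ∈ Finset.range (k + 1 + 1), (-1 : ℝ) ^ j * ((k + 1).choose j) *
        eval y (zonalPoly x (n + 2 * j)) with hS
  have hS' : (S * W : ℂ) = ∫ φ in (0 : ℝ)..Real.pi, laplaceBase t a φ ^ n *
      (1 - laplaceBase t a φ ^ 2) ^ (k + 1) * (Real.sin φ : ℂ) ^ k := by
    rw [← hsum, hS]
    push_cast
    rfl
  have hbound : |S| * W ≤ (4 * a) ^ (k + 1) * ∫ φ in (0 : ℝ)..Real.pi,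
      Real.sin φ ^ k * Real.exp (-(n * a ^ 2 * Real.sin φ ^ 2 / 2)) := by
    have : |S| * W = ‖(S * W : ℂ)‖ := by simp [abs_of_pos hW]
    rw [this, hS', ← intervalIntegral.integral_const_mul]
    refine norm_integral_le_of_norm_le Real.pi_pos.le (.of_forall fun φ hφ => ?_)
      (Continuous.intervalIntegrable (by fun_prop) _ _)
    have hs : 0 ≤ Real.sin φ := Real.sin_nonneg_of_nonneg_of_le_pi hφ.1.le hφ.2
    rw [norm_mul, norm_mul, norm_pow, norm_pow, norm_pow, Complex.norm_real, Real.norm_eq_abs,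
      abs_of_nonneg hs]
    have e : Real.exp (-(n * a ^ 2 * Real.sin φ ^ 2 / 2)) =
        Real.exp (-(a ^ 2 * Real.sin φ ^ 2 / 2)) ^ n := by
      rw [← Real.exp_nat_mul]
      ring_nf
    rw [e]
    calc _ ≤ Real.exp (-(a ^ 2 * Real.sin φ ^ 2 / 2)) ^ n * (4 * a) ^ (k + 1) *
          Real.sin φ ^ k := by
          gcongr
          · exact norm_laplaceBase_le ha φ
          · exact norm_one_sub_laplaceBase_sq_le ha ha0 φ
      _ = _ := by ring
  rw [div_mul_eq_mul_div, le_div_iff₀ hW]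
  refine hbound.trans ?_
  rcases ha0.eq_or_lt with h | h
  · rw [← h]
    simp only [mul_zero, ne_eq, Nat.add_eq_zero_iff, one_ne_zero, and_false, not_false_eq_true,
      zero_pow, zero_mul]
    positivity
  · refine (mul_le_mul_of_nonneg_left
      (integral_sin_pow_mul_exp_le k (show 0 < n * a ^ 2 by positivity)) (by positivity)).trans
      (le_of_eq ?_)
    have e1 : 2 * (n * a ^ 2) / Real.pi ^ 2 = 2 / Real.pi ^ 2 * n * a ^ 2 := by ring
    have e2 : (a ^ 2) ^ (-((k : ℝ) + 1) / 2) = (a ^ (k + 1))⁻¹ := by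
      rw [← Real.rpow_natCast a 2, ← Real.rpow_mul ha0, ← Real.rpow_natCast a (k + 1),
        ← Real.rpow_neg ha0]
      congr 1
      push_cast
      ring
    rw [e1, Real.mul_rpow (by positivity) (by positivity), Real.mul_rpow (by positivity) hn0.le,
      e2, mul_pow]
    field_simp

end KernelBound

section Assembly

open MvPolynomial

variable {d : ℕ}

instance : IsFiniteMeasure (sphMeasure d) := by
  unfold sphMeasure
  infer_instance

lemma sphMeasure_real_univ_pos (hd : 3 ≤ d) : 0 < (sphMeasure d).real Set.univ := by
  have : Nonempty (Fin d) := ⟨⟨0, by omega⟩⟩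
  have h : sphMeasure d ≠ 0 := (volume : Measure (EuclideanSpace ℝ (Fin d))).toSphere_ne_zero
  have : NeZero (sphMeasure d) := ⟨h⟩
  exact measureReal_univ_pos

lemma integrable_coeFn_Lp_two (f : Lp ℝ 2 (sphMeasure d)) : Integrable f (sphMeasure d) :=
  (Lp.memLp f).integrable one_le_two

/-- Elements of `Hspace d k` are represented by harmonic homogeneous polynomials. -/
lemma exists_ae_eq_eval_of_mem_Hspace {k : ℕ} {f : Lp ℝ 2 (sphMeasure d)} (hf : f ∈ Hspace d k) :
    ∃ P : MvPolynomial (Fin d) ℝ, P.IsHomogeneous k ∧ polyLaplacian d P = 0 ∧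
      ⇑f =ᵐ[sphMeasure d] fun y => eval (fun j => (y : EuclideanSpace ℝ (Fin d)) j) P := by
  induction hf using Submodule.span_induction with
  | mem f hf =>
    obtain ⟨Y, ⟨P, hP, hP0, hY⟩, hf⟩ := hf
    exact ⟨P, hP, by rwa [polyLaplacian_apply], hf.trans (.of_forall hY)⟩
  | zero =>
    refine ⟨0, isHomogeneous_zero _ _ _, map_zero _, ?_⟩
    filter_upwards [Lp.coeFn_zero ℝ 2 (sphMeasure d)] with y hy
    rw [map_zero]
    exact hy
  | add f g _ _ hf hg =>
    obtain ⟨P, hP, hP0, hf⟩ := hf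
    obtain ⟨Q, hQ, hQ0, hg⟩ := hg
    refine ⟨P + Q, hP.add hQ, by rw [map_add, hP0, hQ0, add_zero], ?_⟩
    filter_upwards [Lp.coeFn_add f g, hf, hg] with y h1 h2 h3
    rw [h1, Pi.add_apply, h2, h3, map_add]
  | smul a f _ hf =>
    obtain ⟨P, hP, hP0, hf⟩ := hf
    refine ⟨a • P, ?_, by rw [map_smul, hP0, smul_zero], ?_⟩
    · rw [smul_eq_C_mul]
      exact isHomogeneous_C_mul' a hP
    filter_upwards [Lp.coeFn_smul a f, hf] with y h1 h2
    rw [h1, Pi.smul_apply, h2, smul_eval, smul_eq_mul]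

lemma integral_mul_eval_eq_zero_of_inner {k : ℕ} {f : Lp ℝ 2 (sphMeasure d)}
    (hf : ∀ g ∈ Hspace d k, @inner ℝ _ _ f g = 0) {P : MvPolynomial (Fin d) ℝ}
    (hP : P.IsHomogeneous k) (hP0 : polyLaplacian d P = 0) :
    ∫ y : Sph d, eval (fun j => (y : EuclideanSpace ℝ (Fin d)) j) P * f y ∂sphMeasure d = 0 := by
  have hm : MemLp (fun y : Sph d => eval (fun j => (y : EuclideanSpace ℝ (Fin d)) j) P) 2
      (sphMeasure d) :=
    (continuous_eval_sphere P).memLp_of_hasCompactSupport (.of_compactSpace _)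
  have h := hf (hm.toLp _) (Submodule.subset_span
    ⟨_, ⟨P, hP, by rwa [polyLaplacian_apply] at hP0, fun _ => rfl⟩, hm.coeFn_toLp⟩)
  rw [L2.inner_def] at h
  rw [← h]
  refine integral_congr_ae ?_
  filter_upwards [hm.coeFn_toLp] with y hy
  simp [hy]

lemma integrable_eval_mul (P : MvPolynomial (Fin d) ℝ) (f : Lp ℝ 2 (sphMeasure d)) :
    Integrable (fun y : Sph d => eval (fun j => (y : EuclideanSpace ℝ (Fin d)) j) P * f y)
      (sphMeasure d) := by
  obtain ⟨C, hC⟩ :=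
    isCompact_univ.exists_bound_of_continuousOn (continuous_eval_sphere P).continuousOn
  exact (integrable_coeFn_Lp_two f).bdd_mul (continuous_eval_sphere P).aestronglyMeasurable
    (.of_forall fun y => hC y (Set.mem_univ y))

/-- Orthogonal projections onto spherical harmonics as integral operators. -/
lemma ae_eq_integral_zonalPoly_mul (hd : 3 ≤ d) {k : ℕ}
    {T : Lp ℝ 2 (sphMeasure d) → Lp ℝ 2 (sphMeasure d)} (hT : IsOrthProjOnto d k T)
    (f : Lp ℝ 2 (sphMeasure d)) :
    ∀ᵐ x ∂sphMeasure d, T f x = cCoef d k / ((sphMeasure d).real Set.univ * cCoef d 0) *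
      ∫ y : Sph d, eval (fun j => (y : EuclideanSpace ℝ (Fin d)) j)
        (zonalPoly (fun j => (x : EuclideanSpace ℝ (Fin d)) j) k) * f y ∂sphMeasure d := by
  obtain ⟨hmem, horth⟩ := hT f
  obtain ⟨P, hP, hP0, hTP⟩ := exists_ae_eq_eval_of_mem_Hspace hmem
  filter_upwards [hTP] with x hx
  set Z := zonalPoly (fun j => (x : EuclideanSpace ℝ (Fin d)) j) k
  have h1 := integral_mul_eval_eq_zero_of_inner horth (isHomogeneous_zonalPoly _ k)
    (polyLaplacian_zonalPoly _ hd (sum_sq_eq_one x) k)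
  have h2 : ∫ y : Sph d, eval (fun j => (y : EuclideanSpace ℝ (Fin d)) j) Z * (f - T f) y
      ∂sphMeasure d = (∫ y : Sph d, eval (fun j => (y : EuclideanSpace ℝ (Fin d)) j) Z * f y
      ∂sphMeasure d) - sphIntegral d (Z * P) := by
    rw [sphIntegral_apply, ← integral_sub (integrable_eval_mul Z f) (integrable_eval_sphere _)]
    refine integral_congr_ae ?_
    filter_upwards [Lp.coeFn_sub f (T f), hTP] with y h1 h2
    rw [h1, Pi.sub_apply, h2, map_mul, mul_sub]
  rw [h1, sphIntegral_zonalPoly_mul hd (sum_sq_eq_one x) k hP hP0, eq_comm, sub_eq_zero] at h2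
  have hσ := (sphMeasure_real_univ_pos hd).ne'
  have hc := (cCoef_pos hd 0).ne'
  have hk := (cCoef_pos hd k).ne'
  rw [h2, hx]
  field_simp

lemma ae_Tconv_eq (hd : 3 ≤ d) {proj : ℕ → Lp ℝ 2 (sphMeasure d) → Lp ℝ 2 (sphMeasure d)}
    (hproj : ∀ k, IsOrthProjOnto d k (proj k)) (n : ℕ) (f : Lp ℝ 2 (sphMeasure d)) :
    ∀ᵐ x ∂sphMeasure d, Tconv d proj n f x =
      cCoef d n / ((sphMeasure d).real Set.univ * cCoef d 0) *
      ∫ y : Sph d, (∑ j ∈ Finset.range (d - 1), (-1 : ℝ) ^ j * ((d - 2).choose j) *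
        eval (fun j => (y : EuclideanSpace ℝ (Fin d)) j)
          (zonalPoly (fun j => (x : EuclideanSpace ℝ (Fin d)) j) (n + 2 * j))) * f y
          ∂sphMeasure d := by
  have h (j : ℕ) := ae_eq_integral_zonalPoly_mul hd (hproj (n + 2 * j)) f
  have hs : ⇑(Tconv d proj n f) =ᵐ[sphMeasure d] fun x => ∑ j ∈ Finset.range (d - 1),
      ((-1 : ℝ) ^ j * ((d - 2).choose j : ℝ) * (cCoef d n / cCoef d (n + 2 * j))) *
        proj (n + 2 * j) f x := by
    unfold Tconv
    refine (Lp.coeFn_finsetSum _ _).trans ?_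
    have (j : ℕ) := Lp.coeFn_smul
      ((-1 : ℝ) ^ j * ((d - 2).choose j : ℝ) * (cCoef d n / cCoef d (n + 2 * j)))
      (proj (n + 2 * j) f)
    filter_upwards [ae_all_iff.2 this] with x hx
    simp only [Finset.sum_apply, hx, Pi.smul_apply, smul_eq_mul]
  filter_upwards [hs, ae_all_iff.2 h] with x h1 h2
  simp only [h1, h2, Finset.sum_mul, mul_assoc]
  rw [integral_finsetSum]
  · rw [Finset.mul_sum]
    refine Finset.sum_congr rfl fun j _ => ?_
    simp only [integral_const_mul]
    have hk := (cCoef_pos hd (n + 2 * j)).ne'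
    field_simp
  · exact fun j _ => ((integrable_eval_mul _ f).const_mul _).const_mul _

end Assembly

/-- Estimate (2.3): `‖T_n f‖_∞ ≤ C n^λ ‖f‖_1` for all `f ∈ L²(S^{d-1}, σ)`,
where `λ = (d-2)/2`. -/
theorem Tconv_bound_infty_one
    (d : ℕ) (hd : 3 ≤ d)
    (proj : ℕ → Lp ℝ 2 (sphMeasure d) → Lp ℝ 2 (sphMeasure d))
    (hproj : ∀ k, IsOrthProjOnto d k (proj k)) :
    ∃ C : ℝ, 0 < C ∧ ∀ n : ℕ, 1 ≤ n → ∀ f : Lp ℝ 2 (sphMeasure d),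
      eLpNorm (⇑(Tconv d proj n f)) ∞ (sphMeasure d) ≤
        ENNReal.ofReal (C * (n : ℝ) ^ (((d : ℝ) - 2) / 2)) *
          eLpNorm (⇑f) 1 (sphMeasure d) := by
  obtain ⟨A, hA, hcA⟩ := exists_cCoef_le hd
  obtain ⟨B, hB, hzB⟩ := exists_abs_sum_zonalPoly_le hd
  have hσ := sphMeasure_real_univ_pos hd
  have hc0 := cCoef_pos hd 0
  refine ⟨A * B / ((sphMeasure d).real Set.univ * cCoef d 0), by positivity, fun n hn f => ?_⟩
  have hn0 : (0 : ℝ) < n := by exact_mod_cast hn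
  have hf := integrable_coeFn_Lp_two f
  have hpow : (n : ℝ) ^ (((d : ℝ) - 2) / 2) =
      (n : ℝ) ^ (d - 2) * (n : ℝ) ^ (-(((d : ℝ) - 2) / 2)) := by
    rw [← Real.rpow_natCast, ← Real.rpow_add hn0]
    congr 1
    push_cast [Nat.cast_sub (show 2 ≤ d by omega)]
    ring
  rw [eLpNorm_exponent_top, eLpNorm_one_eq_lintegral_enorm,
    ← ofReal_integral_norm_eq_lintegral_enorm hf, ← ENNReal.ofReal_mul (by positivity)]
  refine eLpNormEssSup_le_of_ae_bound ?_
  filter_upwards [ae_Tconv_eq hd hproj n f] with x hx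
  rw [hx, norm_mul, Real.norm_of_nonneg (div_pos (cCoef_pos hd n) (mul_pos hσ hc0)).le]
  have hint := norm_integral_le_of_norm_le
    (hf.norm.const_mul (B * (n : ℝ) ^ (-(((d : ℝ) - 2) / 2))))
    (.of_forall fun y => (norm_mul _ (f y)).le.trans (mul_le_mul_of_nonneg_right
      (hzB n hn _ _ (sum_sq_eq_one x) (sum_sq_eq_one y)) (norm_nonneg (f y))))
  rw [integral_const_mul] at hint
  refine (mul_le_mul (div_le_div_of_nonneg_right (hcA n hn) (mul_pos hσ hc0).le) hint
    (norm_nonneg _) (by positivity)).trans (le_of_eq ?_)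
  rw [hpow]
  ring
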